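/- Define the linear map M2 on (ℝ²)^{n²} by (M2 A)_u = A_{(u, τ_k(u))} for u ∈ [k] (viewing u ∈ [k] as the u-th element of [n²]) and all other coordinates of M2 A equal to (0,0). Then for every Z_I-invariant function ψ : X → ℝ there exists a block-S_{n²}-invariant function φ : (ℝ²)^{n²} × (ℝ²)^n → ℝ such that ψ(x) = φ(M2(ρ_n(M1 x)), Q(x)) for all x ∈ X. -/

import Mathlib

/-- Action of a permutation `g` on tuples: `(g · x)_i = x_{g i}`. -/
def permAct {ι α : Type*} (g : Equiv.Perm ι) (x : ι → α) : ι → α := fun i => x (g i)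

/-- `X`: points of `[0,1]^n` with pairwise distinct coordinates. -/
def Xset (n : ℕ) : Set (Fin n → ℝ) :=
  {x | (∀ i, x i ∈ Set.Icc (0 : ℝ) 1) ∧ Function.Injective x}

/-- `ρ_n(x)_{(a,b)} = (x_a, x_b)`, indexing `(ℝ²)^{n²}` by `[n] × [n]`
(lexicographically: the pair `(a,b)` is the element number `a·n + b` of `[n²]`,
zero-indexed). -/
def rhoN (n : ℕ) (x : Fin n → ℝ) : Fin n × Fin n → ℝ × ℝ := fun p => (x p.1, x p.2)

/-- `M1`: `(M1 x)_u = x_{i_u}` for `u ∈ [k]` and `0` otherwise, where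
`e : Fin k → Fin n` enumerates `I = {i_1 < … < i_k}`. -/
def M1map (n k : ℕ) (e : Fin k → Fin n) (x : Fin n → ℝ) : Fin n → ℝ :=
  fun u => if h : u.val < k then x (e ⟨u.val, h⟩) else 0

/-- `Q(x)_u = (((I_n − M1)x)_u, 0)`. -/
def Qmap (n k : ℕ) (e : Fin k → Fin n) (x : Fin n → ℝ) : Fin n → ℝ × ℝ :=
  fun u => (x u - M1map n k e x u, 0)

/-- `M2` for the locally cyclic case: the `u`-th coordinate of `M2 A`
(for `u ∈ [k]`, viewing `u` as the `u`-th element of `[n²]` lexicographically,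
i.e. the pair at zero-indexed lex position `q.1 * n + q.2`) is `A_{(u, τ_k(u))}`,
and all other coordinates are `(0,0)`. -/
def M2Z (n k : ℕ) (hkn : k ≤ n) (A : Fin n × Fin n → ℝ × ℝ) :
    Fin n × Fin n → ℝ × ℝ := fun q =>
  if h : q.1.val * n + q.2.val < k then
    A (Fin.castLE hkn ⟨q.1.val * n + q.2.val, h⟩,
       Fin.castLE hkn (finRotate k ⟨q.1.val * n + q.2.val, h⟩))
  else 0

theorem exists_pow_finRotate_apply_eq {k : ℕ} (hk : 2 ≤ k) (u v : Fin k) :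
    ∃ m : ℕ, (finRotate k ^ m) u = v := by
  have hc : (finRotate k).IsCycle := isCycle_finRotate_of_le hk
  have hs : (finRotate k).support = Finset.univ := support_finRotate_of_le hk
  have hu : finRotate k u ≠ u := Equiv.Perm.mem_support.1 (by simp [hs])
  have hv : finRotate k v ≠ v := Equiv.Perm.mem_support.1 (by simp [hs])
  exact hc.exists_pow_eq hu hv

/-- The value of `M2 ∘ ρ_n ∘ M1` is either an edge of the cyclic tuple `x ∘ e` or zero. -/
theorem M2Z_rhoN_M1map (n k : ℕ) (hkn : k ≤ n) (e : Fin k → Fin n) (x : Fin n → ℝ)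
    (q : Fin n × Fin n) :
    M2Z n k hkn (rhoN n (M1map n k e x)) q =
      if h : q.1.val * n + q.2.val < k then
        (x (e ⟨q.1.val * n + q.2.val, h⟩), x (e (finRotate k ⟨q.1.val * n + q.2.val, h⟩)))
      else 0 := by
  unfold M2Z
  split_ifs with h
  · simp [rhoN, M1map, h]
  · rfl

/-- If the edge tuples of `x` and `y` agree up to a permutation, then every edge of `y ∘ e`
is an edge of `x ∘ e`. -/
theorem exists_edge_eq {n k : ℕ} (hk : 2 ≤ k) (hkn : k ≤ n)
    {e : Fin k → Fin n} (he : Function.Injective e) {x y : Fin n → ℝ}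
    (hy : Function.Injective y) (g : Equiv.Perm (Fin n × Fin n))
    (hg : M2Z n k hkn (rhoN n (M1map n k e y)) =
      permAct g (M2Z n k hkn (rhoN n (M1map n k e x)))) (u : Fin k) :
    ∃ w : Fin k, y (e u) = x (e w) ∧ y (e (finRotate k u)) = x (e (finRotate k w)) := by
  have hn : 0 < n := by omega
  have h := congrFun hg (⟨0, hn⟩, Fin.castLE hkn u)
  unfold permAct at h
  rw [M2Z_rhoN_M1map, M2Z_rhoN_M1map] at h
  simp only [zero_mul, Fin.val_castLE, zero_add, Fin.is_lt, dite_true, Fin.eta] at h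
  split_ifs at h with hw
  · exact ⟨_, congrArg Prod.fst h, congrArg Prod.snd h⟩
  · have h0 : y (e (finRotate k u)) = y (e u) :=
      (congrArg Prod.snd h).trans (congrArg Prod.fst h).symm
    have hs : (finRotate k).support = Finset.univ := support_finRotate_of_le hk
    exact absurd (he (hy h0)) (Equiv.Perm.mem_support.1 (by simp [hs]))

theorem apply_pow_eq_of_edges {k : ℕ} {α : Type*} {a b : Fin k → α} (ha : Function.Injective a)
    (hab : ∀ u, ∃ w, b u = a w ∧ b (finRotate k u) = a (finRotate k w)) {u w : Fin k}
    (huw : b u = a w) (m : ℕ) : b ((finRotate k ^ m) u) = a ((finRotate k ^ m) w) := by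
  induction m with
  | zero => simpa using huw
  | succ m ih =>
    obtain ⟨w', h1, h2⟩ := hab ((finRotate k ^ m) u)
    have hw : w' = (finRotate k ^ m) w := ha (h1.symm.trans ih)
    rw [pow_succ', Equiv.Perm.mul_apply, Equiv.Perm.mul_apply, h2, hw]

theorem eq_of_Qmap_eq {n k : ℕ} {e : Fin k → Fin n} {x y : Fin n → ℝ}
    (hQ : Qmap n k e x = Qmap n k e y) {v : Fin n}
    (hv : ∀ h : v.val < k, y (e ⟨v, h⟩) = x (e ⟨v, h⟩)) : y v = x v := by
  have h := congrArg Prod.fst (congrFun hQ v)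
  simp only [Qmap, M1map] at h
  split_ifs at h with hvk
  · linarith [hv hvk]
  · linarith

/-- Beyond the first index displaced by `e`, the map `Q` determines the point. -/
theorem eq_of_Qmap_eq_of_lt {n k : ℕ} {e : Fin k → Fin n} (he : StrictMono e) {x y : Fin n → ℝ}
    (hQ : Qmap n k e x = Qmap n k e y) {u : Fin k} (hu : u.val < (e u).val)
    (v : Fin n) (huv : u.val ≤ v.val) : y v = x v := by
  refine eq_of_Qmap_eq hQ fun h => ?_
  have hlt : v.val < (e ⟨v, h⟩).val := by
    have key : ∀ d : ℕ, ∀ hd : u.val + d < k, u.val + d < (e ⟨u.val + d, hd⟩).val := by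
      intro d
      induction d with
      | zero => exact fun _ => hu
      | succ d ih =>
        intro hd
        have h1 := ih (by omega)
        have h2 : e ⟨u.val + d, by omega⟩ < e ⟨u.val + (d + 1), hd⟩ := he (by simp)
        have h3 := Fin.lt_def.1 h2
        omega
    have h1 := key (v.val - u.val) (by omega)
    have h2 : u.val + (v.val - u.val) = v.val := by omega
    simpa only [h2] using h1
  exact eq_of_Qmap_eq_of_lt he hQ hu _ (by omega)
termination_by n - v.val
decreasing_by omega

theorem pow_apply_of_semiconj {k n : ℕ} {e : Fin k → Fin n} {π : Equiv.Perm (Fin n)}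
    (hπ : ∀ u : Fin k, π (e u) = e (finRotate k u)) (m : ℕ) (u : Fin k) :
    (π ^ m) (e u) = e ((finRotate k ^ m) u) := by
  induction m with
  | zero => simp
  | succ m ih => rw [pow_succ', pow_succ', Equiv.Perm.mul_apply, Equiv.Perm.mul_apply, ih, hπ]

/-- The pair of invariants `(M2 ∘ ρ_n ∘ M1, Q)` separates the orbits of the local cyclic shift. -/
theorem exists_pow_permAct_eq {n k : ℕ} (hk : 2 ≤ k) (hkn : k ≤ n)
    {e : Fin k → Fin n} (he : StrictMono e) {π : Equiv.Perm (Fin n)}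
    (hπ : ∀ u : Fin k, π (e u) = e (finRotate k u))
    (hπ' : ∀ j, j ∉ Set.range e → π j = j)
    {x y : Fin n → ℝ} (hx : Function.Injective x) (hy : Function.Injective y)
    (g : Equiv.Perm (Fin n × Fin n))
    (hg : M2Z n k hkn (rhoN n (M1map n k e y)) =
      permAct g (M2Z n k hkn (rhoN n (M1map n k e x))))
    (hQ : Qmap n k e x = Qmap n k e y) : ∃ m : ℕ, y = permAct (π ^ m) x := by
  have hedge := exists_edge_eq hk hkn he.injective hy g hg
  have hxe : Function.Injective (x ∘ e) := hx.comp he.injective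
  by_cases hfix : ∀ u : Fin k, (e u).val ≤ u.val
  · obtain ⟨w, hw, -⟩ := hedge ⟨0, by omega⟩
    obtain ⟨m, hm⟩ := exists_pow_finRotate_apply_eq hk ⟨0, by omega⟩ w
    refine ⟨m, funext fun j => ?_⟩
    by_cases hj : j ∈ Set.range e
    · obtain ⟨v, rfl⟩ := hj
      obtain ⟨l, rfl⟩ := exists_pow_finRotate_apply_eq hk ⟨0, by omega⟩ v
      have h := apply_pow_eq_of_edges (b := y ∘ e) hxe hedge hw l
      rw [permAct, pow_apply_of_semiconj hπ, ← Equiv.Perm.mul_apply, ← pow_add, add_comm, pow_add,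
        Equiv.Perm.mul_apply, hm]
      exact h
    · rw [permAct, Equiv.Perm.pow_apply_eq_self_of_apply_eq_self (hπ' j hj)]
      refine eq_of_Qmap_eq hQ fun h => absurd ⟨⟨j, h⟩, Fin.ext ?_⟩ hj
      have hid : ∀ d : ℕ, ∀ hd : d < k, d ≤ (e ⟨d, hd⟩).val := by
        intro d
        induction d with
        | zero => exact fun _ => Nat.zero_le _
        | succ d ih =>
          intro hd
          have h1 := ih (by omega)
          have h2 : e ⟨d, by omega⟩ < e ⟨d + 1, hd⟩ := he (by simp)
          have h3 := Fin.lt_def.1 h2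
          omega
      exact le_antisymm (hfix _) (hid _ h)
  · push Not at hfix
    obtain ⟨u, hu⟩ := hfix
    have hu' : y (e u) = x (e u) := eq_of_Qmap_eq_of_lt he hQ hu _ hu.le
    refine ⟨0, funext fun j => ?_⟩
    refine eq_of_Qmap_eq hQ fun h => ?_
    obtain ⟨l, hl⟩ := exists_pow_finRotate_apply_eq hk u ⟨j, h⟩
    rw [← hl]
    exact apply_pow_eq_of_edges (b := y ∘ e) hxe hedge hu' l

/-- Any `Z_I`-invariant `ψ : X → ℝ` is expressible as
`x ↦ φ(M2(ρ_n(M1 x)), Q(x))` with `φ` block-`S_{n²}`-invariant. Here `π ∈ S_n`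
is the local cyclic shift on `I` and `Z_I = ⟨π⟩`. -/
theorem stmt_10 (n k : ℕ) (hn : 2 ≤ n) (hk : 2 ≤ k) (hkn : k ≤ n)
    (e : Fin k → Fin n) (he : StrictMono e)
    (π : Equiv.Perm (Fin n))
    (hπ : ∀ u : Fin k, π (e u) = e (finRotate k u))
    (hπ' : ∀ j, j ∉ Set.range e → π j = j)
    (ψ : (Fin n → ℝ) → ℝ)
    (hψ : ∀ g ∈ Subgroup.zpowers π, ∀ x ∈ Xset n, ψ (permAct g x) = ψ x) :
    ∃ φ : ((Fin n × Fin n → ℝ × ℝ) × (Fin n → ℝ × ℝ)) → ℝ,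
      (∀ (g : Equiv.Perm (Fin n × Fin n)) (A : Fin n × Fin n → ℝ × ℝ)
        (q : Fin n → ℝ × ℝ), φ (permAct g A, q) = φ (A, q)) ∧
      ∀ x ∈ Xset n,
        ψ x = φ (M2Z n k hkn (rhoN n (M1map n k e x)), Qmap n k e x) := by
  classical
  let P : ((Fin n × Fin n → ℝ × ℝ) × (Fin n → ℝ × ℝ)) → (Fin n → ℝ) → Prop := fun p x =>
    x ∈ Xset n ∧ (∃ g, p.1 = permAct g (M2Z n k hkn (rhoN n (M1map n k e x)))) ∧
      Qmap n k e x = p.2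
  refine ⟨fun p => if h : ∃ x, P p x then ψ h.choose else 0, fun g A q => ?_, fun x hx => ?_⟩
  · have hP : P (permAct g A, q) = P (A, q) := by
      funext x
      refine propext (and_congr_right fun _ => and_congr_left fun _ => ⟨?_, ?_⟩)
      · rintro ⟨h, hh⟩
        refine ⟨h * g⁻¹, funext fun i => ?_⟩
        simpa [permAct] using congrFun hh (g⁻¹ i)
      · rintro ⟨h, hh⟩
        refine ⟨h * g, funext fun i => ?_⟩
        exact congrFun hh (g i)
    simp only [hP]
  · have hex : ∃ x', P (M2Z n k hkn (rhoN n (M1map n k e x)), Qmap n k e x) x' :=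
      ⟨x, hx, ⟨1, rfl⟩, rfl⟩
    dsimp only
    rw [dif_pos hex]
    obtain ⟨hx', ⟨g, hg⟩, hQ⟩ := hex.choose_spec
    obtain ⟨m, hm⟩ := exists_pow_permAct_eq hk hkn he hπ hπ' hx'.2 hx.2 g hg hQ
    conv_lhs => rw [hm]
    exact hψ _ (Subgroup.npow_mem_zpowers π m) _ hx'
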